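/- There do not exist real numbers b₁, b₂, b₃, a₁, a₂, a₃, C with b₁, b₂, b₃ pairwise distinct satisfying all five equations: a₁ - a₂ = (b₂ - b₁)·b₂; a₁ - a₃ = (b₃ - b₁)·b₃; b₁b₂ + a₁ + a₂ = -C²/(b₁ - b₂)²; b₁b₃ + a₁ + a₃ = -C²/(b₁ - b₃)²; and b₂b₃ + a₂ + a₃ = -C²/((b₁ - b₂)(b₁ - b₃)). (Any such solution would force 2b₁ = b₂ + b₃ and then -(b₂ - b₃)⁴/16 = C² ≥ 0, a contradiction.) -/

import Mathlib

/-- The algebraic contradiction at the heart of the Vanishing Theorem: there are no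
reals `b₁, b₂, b₃` (pairwise distinct Möbius principal curvatures), `a₁, a₂, a₃`
(Blaschke eigenvalues) and `C` (Möbius form component) satisfying the five structure
relations.  (Such a solution would force `2b₁ = b₂ + b₃` and then
`-(b₂-b₃)⁴/16 = C² ≥ 0`, a contradiction.) -/
theorem no_solution_vanishing (b₁ b₂ b₃ a₁ a₂ a₃ C : ℝ)
    (h12 : b₁ ≠ b₂) (h13 : b₁ ≠ b₃) (h23 : b₂ ≠ b₃)
    (e1 : a₁ - a₂ = (b₂ - b₁) * b₂)
    (e2 : a₁ - a₃ = (b₃ - b₁) * b₃)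
    (e3 : b₁ * b₂ + a₁ + a₂ = -C ^ 2 / (b₁ - b₂) ^ 2)
    (e4 : b₁ * b₃ + a₁ + a₃ = -C ^ 2 / (b₁ - b₃) ^ 2)
    (e5 : b₂ * b₃ + a₂ + a₃ = -C ^ 2 / ((b₁ - b₂) * (b₁ - b₃))) :
    False := by
  have hx : b₁ - b₂ ≠ 0 := sub_ne_zero.mpr h12
  have hy : b₁ - b₃ ≠ 0 := sub_ne_zero.mpr h13
  rw [eq_div_iff (pow_ne_zero 2 hx)] at e3
  rw [eq_div_iff (mul_ne_zero hx hy)] at e5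
  obtain rfl : a₂ = a₁ - (b₂ - b₁) * b₂ := by linarith
  obtain rfl : a₃ = a₁ - (b₃ - b₁) * b₃ := by linarith
  have hT : 2 * a₁ + b₁ ^ 2 = (b₁ - b₂) ^ 2 + (b₁ - b₃) ^ 2 := by
    apply mul_left_cancel₀ (mul_ne_zero hx (sub_ne_zero.mpr h23))
    linear_combination e5 - e3
  have hC : C ^ 2 = -((b₁ - b₂) * (b₁ - b₃)) ^ 2 := by
    linear_combination e3 - (b₁ - b₂) ^ 2 * hT
  have hpos : 0 < ((b₁ - b₂) * (b₁ - b₃)) ^ 2 := by positivity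
  linarith [sq_nonneg C]
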